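/- (Proposition 5.1, bounds on the pseudospectral radius of the Jordan block) For every n ∈ ℕ and every ε ≥ 0: 1 + ε ≤ α_n(ε_n + ε) ≤ 1 + ε + min{ε_n, √(2 ε_n ε)}. -/

import Mathlib

open scoped Real

noncomputable section

namespace SpecInclJL

/-- The smallest singular value of a (possibly rectangular) complex matrix,
as the infimum of `‖F x‖` over the unit sphere. -/
noncomputable def sval {ι κ : Type*} [Fintype ι] [Fintype κ] [DecidableEq κ]
    (F : Matrix ι κ ℂ) : ℝ :=
  sInf {y : ℝ | ∃ x : EuclideanSpace ℂ κ, ‖x‖ = 1 ∧ y = ‖Matrix.toEuclideanLin F x‖}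

/-- The closed ε-pseudospectrum of a square complex matrix. -/
noncomputable def pspec {ι : Type*} [Fintype ι] [DecidableEq ι] (ε : ℝ)
    (E : Matrix ι ι ℂ) : Set ℂ :=
  {z : ℂ | sval (E - z • (1 : Matrix ι ι ℂ)) ≤ ε}

/-- The n×n Jordan block `V_n` (zero diagonal, ones on the superdiagonal). -/
def Vm (n : ℕ) : Matrix (Fin n) (Fin n) ℂ :=
  fun i j => if (i : ℕ) + 1 = (j : ℕ) then 1 else 0

/-- The periodised Jordan block `V^{per,t}_n`: `V_n` plus the entry `t̄` in
position (n,1) (1-based); `V^{per,t}_1 = t̄`. -/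
def Vper (n : ℕ) (t : ℂ) : Matrix (Fin n) (Fin n) ℂ :=
  fun i j => (if (i : ℕ) + 1 = (j : ℕ) then 1 else 0)
    + (if (i : ℕ) = n - 1 ∧ (j : ℕ) = 0 then (starRingEnd ℂ) t else 0)

/-- The (n+2)×n matrix `V⁺_n`: first row `(1,0,…,0)`, middle n rows `V_n`,
last row zero. -/
def VP (n : ℕ) : Matrix (Fin (n + 2)) (Fin n) ℂ :=
  fun i j => if ((i : ℕ) = 0 ∧ (j : ℕ) = 0) ∨
    (1 ≤ (i : ℕ) ∧ (i : ℕ) ≤ n ∧ (j : ℕ) = (i : ℕ)) then 1 else 0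

/-- The (n+2)×n matrix `Ṽ⁺_n`: zero first and last rows, middle part `V_n`. -/
def VtP (n : ℕ) : Matrix (Fin (n + 2)) (Fin n) ℂ :=
  fun i j => if 1 ≤ (i : ℕ) ∧ (i : ℕ) ≤ n ∧ (j : ℕ) = (i : ℕ) then 1 else 0

/-- The (n+2)×n matrix `I⁺_n`: middle part the identity, first and last rows
zero. -/
def IP (n : ℕ) : Matrix (Fin (n + 2)) (Fin n) ℂ :=
  fun i j => if (i : ℕ) = (j : ℕ) + 1 then 1 else 0

/-- The closed ε-pseudospectrum of an (n+2)×n matrix `E⁺`: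
`{λ : s_min(E⁺ − λ I⁺_n) ≤ ε}`. -/
noncomputable def pspecR {n : ℕ} (ε : ℝ) (E : Matrix (Fin (n + 2)) (Fin n) ℂ) :
    Set ℂ :=
  {z : ℂ | sval (E - z • IP n) ≤ ε}

/-- ε_n := 2 sin(π/(4n+2)). -/
noncomputable def epsV (n : ℕ) : ℝ := 2 * Real.sin (Real.pi / (4 * (n : ℝ) + 2))

/-- ε'_n := 2 sin(π/(2n)). -/
noncomputable def epsV' (n : ℕ) : ℝ := 2 * Real.sin (Real.pi / (2 * (n : ℝ)))

/-- ε''_n := 2 sin(π/(2n+2)). -/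
noncomputable def epsV'' (n : ℕ) : ℝ := 2 * Real.sin (Real.pi / (2 * (n : ℝ) + 2))

/-- The τ-method inclusion set `Σ^n_ε(V_N)` (independent of `N ≥ n+1`). -/
noncomputable def SigmaV (n : ℕ) (ε : ℝ) : Set ℂ :=
  if n ≤ 2 then ⋃ m : Fin n, pspec (ε + epsV n) (Vm (m + 1))
  else pspec (ε + epsV (n - 2)) (Vm n) ∩ ⋃ m : Fin n, pspec (ε + epsV n) (Vm (m + 1))

/-- The π-method inclusion set `Π^{n,t}_ε(V_N)`. -/
noncomputable def PiV (n : ℕ) (t : ℂ) (ε : ℝ) : Set ℂ :=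
  pspec (ε + epsV' n) (Vm n) ∪ pspec (ε + epsV' n) (Vper n t)

/-- The τ₁-method inclusion set `Γ^n_ε(V_N)`. -/
noncomputable def GammaV (n : ℕ) (ε : ℝ) : Set ℂ :=
  pspecR (ε + epsV'' n) (VP n) ∪ pspecR (ε + epsV'' n) (VtP n)

/-- The closed disc of radius `r` centred at the origin. -/
def cDisc (r : ℝ) : Set ℂ := {z : ℂ | ‖z‖ ≤ r}

/-- The n×n discrete Laplacian `L_n` (zero diagonal, ones on the first sub-
and superdiagonals). -/
def Lm (n : ℕ) : Matrix (Fin n) (Fin n) ℂ :=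
  fun i j => if (i : ℕ) + 1 = (j : ℕ) ∨ (j : ℕ) + 1 = (i : ℕ) then 1 else 0

/-- θ_n for the discrete Laplacian: the unique solution of
`8 sin(t/2) cos((n+1/2)t) + sin((n−1)t) = 0` in `[π/(2n+1), π/(n+2)]`
(by uniqueness, the infimum of the solution set). -/
noncomputable def thetaL (n : ℕ) : ℝ :=
  sInf {t : ℝ | t ∈ Set.Icc (Real.pi / (2 * (n : ℝ) + 1)) (Real.pi / ((n : ℝ) + 2)) ∧
    8 * Real.sin (t / 2) * Real.cos (((n : ℝ) + 1 / 2) * t)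
      + Real.sin (((n : ℝ) - 1) * t) = 0}

/-- ε_n := 4 sin(θ_n/2) for the discrete Laplacian. -/
noncomputable def epsL (n : ℕ) : ℝ := 4 * Real.sin (thetaL n / 2)

/-- ε''_n := 4 sin(π/(2n+2)) for the discrete Laplacian. -/
noncomputable def epsL'' (n : ℕ) : ℝ := 4 * Real.sin (Real.pi / (2 * (n : ℝ) + 2))

/-- The τ-method inclusion set `Σ^n_ε(L_N)` (independent of `N ≥ n+1`). -/
noncomputable def SigmaL (n : ℕ) (ε : ℝ) : Set ℂ :=
  if n ≤ 2 then ⋃ m : Fin n, pspec (ε + epsL n) (Lm (m + 1))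
  else pspec (ε + epsL (n - 2)) (Lm n) ∩ ⋃ m : Fin n, pspec (ε + epsL n) (Lm (m + 1))

/-- The (n+2)×n matrix `L⁺_n`: first row `(1,0,…,0)`, middle n rows `L_n`,
last row `(0,…,0,1)`. -/
def LP (n : ℕ) : Matrix (Fin (n + 2)) (Fin n) ℂ :=
  fun i j => if ((i : ℕ) = 0 ∧ (j : ℕ) = 0) ∨
      (1 ≤ (i : ℕ) ∧ (i : ℕ) ≤ n ∧ ((j : ℤ) = (i : ℤ) - 2 ∨ (j : ℤ) = (i : ℤ))) ∨
      ((i : ℕ) = n + 1 ∧ (j : ℕ) + 1 = n) then 1 else 0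

/-- The (n+2)×n matrix `L̃⁺_n`: first row `(1,0,…,0)`, middle n rows `L_n`,
last row zero. -/
def LtP (n : ℕ) : Matrix (Fin (n + 2)) (Fin n) ℂ :=
  fun i j => if ((i : ℕ) = 0 ∧ (j : ℕ) = 0) ∨
      (1 ≤ (i : ℕ) ∧ (i : ℕ) ≤ n ∧ ((j : ℤ) = (i : ℤ) - 2 ∨ (j : ℤ) = (i : ℤ)))
    then 1 else 0

/-- The τ₁-method inclusion set `Γ^n_ε(L_N)`. -/
noncomputable def GammaL (N n : ℕ) (ε : ℝ) : Set ℂ :=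
  if n = N - 1 then pspecR (ε + epsL'' n) (LtP n)
  else pspecR (ε + epsL'' n) (LP n) ∪ pspecR (ε + epsL'' n) (LtP n)

/-- The set `[−2,2] + ε·𝔻̄ ⊆ ℂ`. -/
def bandSet (ε : ℝ) : Set ℂ :=
  {z : ℂ | ∃ x : ℝ, x ∈ Set.Icc (-2 : ℝ) 2 ∧ ‖z - (x : ℂ)‖ ≤ ε}

/-- Extension by zero of a vector indexed by `Fin n` to a sequence. -/
def extendZero {n : ℕ} (x : EuclideanSpace ℂ (Fin n)) (k : ℕ) : ℂ :=
  if h : k < n then x ⟨k, h⟩ else 0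

lemma norm_sq_eq_sum_extendZero {n : ℕ} (x : EuclideanSpace ℂ (Fin n)) :
    ‖x‖ ^ 2 = ∑ k ∈ Finset.range n, ‖extendZero x k‖ ^ 2 := by
  rw [EuclideanSpace.norm_sq_eq, Finset.sum_range]
  exact Finset.sum_congr rfl fun i _ => by simp [extendZero]

lemma toEuclideanLin_Vm_sub_apply {n : ℕ} (s : ℝ) (x : EuclideanSpace ℂ (Fin n)) (i : Fin n) :
    Matrix.toEuclideanLin (Vm n - (s : ℂ) • (1 : Matrix (Fin n) (Fin n) ℂ)) x i
      = extendZero x (i + 1) - s * extendZero x i := by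
  have hV : ∑ j, Vm n i j * x j = extendZero x (i + 1) := by
    unfold extendZero Vm
    split_ifs with h
    · rw [Finset.sum_eq_single (⟨i + 1, h⟩ : Fin n)]
      · simp
      · intro j _ hj
        rw [if_neg fun hij => hj (Fin.ext hij.symm), zero_mul]
      · simp
    · refine Finset.sum_eq_zero fun j _ => ?_
      rw [if_neg (by omega), zero_mul]
  have hx : extendZero x i = x i := by simp [extendZero]
  rw [Matrix.toLpLin_apply, PiLp.toLp_apply, Matrix.sub_mulVec, Matrix.smul_mulVec,
    Matrix.one_mulVec, hx, ← hV]
  simp [Matrix.mulVec, dotProduct]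

lemma norm_sq_toEuclideanLin_Vm_sub {n : ℕ} (s : ℝ) (x : EuclideanSpace ℂ (Fin n)) :
    ‖Matrix.toEuclideanLin (Vm n - (s : ℂ) • (1 : Matrix (Fin n) (Fin n) ℂ)) x‖ ^ 2
      = ∑ k ∈ Finset.range n, ‖extendZero x (k + 1) - s * extendZero x k‖ ^ 2 := by
  rw [EuclideanSpace.norm_sq_eq, Finset.sum_range]
  exact Finset.sum_congr rfl fun i _ => by rw [toEuclideanLin_Vm_sub_apply]

section SmallestSingularValue

variable {ι κ : Type*} [Fintype ι] [Fintype κ] [DecidableEq κ]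

lemma sval_nonneg (F : Matrix ι κ ℂ) : 0 ≤ sval F :=
  Real.sInf_nonneg (by rintro _ ⟨x, -, rfl⟩; exact norm_nonneg _)

lemma sval_mul_norm_le (F : Matrix ι κ ℂ) (x : EuclideanSpace ℂ κ) :
    sval F * ‖x‖ ≤ ‖Matrix.toEuclideanLin F x‖ := by
  rcases eq_or_ne x 0 with rfl | hx
  · simp
  have hx' : 0 < ‖x‖ := norm_pos_iff.mpr hx
  have h : sval F ≤ ‖Matrix.toEuclideanLin F (((‖x‖⁻¹ : ℝ) : ℂ) • x)‖ := by
    refine csInf_le ⟨0, ?_⟩ ⟨_, ?_, rfl⟩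
    · rintro _ ⟨y, -, rfl⟩
      exact norm_nonneg _
    · rw [norm_smul, Complex.norm_real, norm_inv, norm_norm, inv_mul_cancel₀ hx'.ne']
  rw [map_smul, norm_smul, Complex.norm_real, norm_inv, norm_norm] at h
  calc sval F * ‖x‖ ≤ ‖x‖⁻¹ * ‖Matrix.toEuclideanLin F x‖ * ‖x‖ := by gcongr
    _ = _ := by field_simp

lemma le_sval_sq [Nonempty κ] (F : Matrix ι κ ℂ) (c : ℝ)
    (h : ∀ x, c * ‖x‖ ^ 2 ≤ ‖Matrix.toEuclideanLin F x‖ ^ 2) : c ≤ sval F ^ 2 := by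
  rcases le_or_gt c 0 with hc | hc
  · exact hc.trans (sq_nonneg _)
  refine (Real.sqrt_le_left (sval_nonneg F)).mp (le_csInf ?_ ?_)
  · obtain ⟨i⟩ := ‹Nonempty κ›
    exact ⟨_, EuclideanSpace.single i 1, by simp, rfl⟩
  · rintro _ ⟨x, hx, rfl⟩
    refine Real.sqrt_le_iff.mpr ⟨norm_nonneg _, ?_⟩
    simpa [hx] using h x

end SmallestSingularValue

/-- A real test sequence bounds the smallest singular value of `V_n - s` from above. -/
lemma sval_Vm_sub_sq_mul_sum_le {n : ℕ} (s : ℝ) (y : ℕ → ℝ) (hy : y n = 0) :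
    sval (Vm n - (s : ℂ) • (1 : Matrix (Fin n) (Fin n) ℂ)) ^ 2 * ∑ k ∈ Finset.range n, y k ^ 2
      ≤ ∑ k ∈ Finset.range n, (y (k + 1) - s * y k) ^ 2 := by
  set x : EuclideanSpace ℂ (Fin n) := WithLp.toLp 2 fun i => (y i : ℂ) with hx
  have hext : ∀ k ≤ n, extendZero x k = y k := by
    intro k hk
    rcases hk.lt_or_eq with h | rfl
    · simp [extendZero, hx, h]
    · simp [extendZero, hy]
  have h := pow_le_pow_left₀ (mul_nonneg (sval_nonneg _) (norm_nonneg _))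
    (sval_mul_norm_le (Vm n - (s : ℂ) • (1 : Matrix (Fin n) (Fin n) ℂ)) x) 2
  rw [mul_pow, norm_sq_eq_sum_extendZero, norm_sq_toEuclideanLin_Vm_sub] at h
  have hnorm : ∀ k ∈ Finset.range n, ‖extendZero x k‖ ^ 2 = y k ^ 2 := by
    intro k hk
    rw [hext k (Finset.mem_range.mp hk).le, Complex.norm_real, Real.norm_eq_abs, sq_abs]
  have himage : ∀ k ∈ Finset.range n,
      ‖extendZero x (k + 1) - s * extendZero x k‖ ^ 2 = (y (k + 1) - s * y k) ^ 2 := by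
    intro k hk
    have hk := Finset.mem_range.mp hk
    rw [hext k hk.le, hext (k + 1) hk, ← Complex.ofReal_mul, ← Complex.ofReal_sub,
      Complex.norm_real, Real.norm_eq_abs, sq_abs]
  rwa [Finset.sum_congr rfl hnorm, Finset.sum_congr rfl himage] at h

/-- The sequence `k ↦ sin ((k + 1) π / (2n + 1))`; read backwards from `n - 1`, it is the singular
vector of `V_n - I` for the smallest singular value. -/
def sinSeq (n k : ℕ) : ℝ := Real.sin (((k : ℝ) + 1) * (Real.pi / (2 * n + 1)))

/-- The sequence `k ↦ sin ((n - k) π / (2n + 1))`, the singular vector of `V_n - I` for the smallest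
singular value. -/
def sinSeqRev (n k : ℕ) : ℝ := Real.sin (((n : ℝ) - k) * (Real.pi / (2 * n + 1)))

lemma epsV_eq (n : ℕ) : epsV n = 2 * Real.sin (Real.pi / (2 * n + 1) / 2) := by
  unfold epsV
  congr 2
  field_simp
  ring

lemma epsV_pos (n : ℕ) : 0 < epsV n := by
  have hπ := Real.pi_pos
  refine mul_pos two_pos (Real.sin_pos_of_pos_of_lt_pi (by positivity) ?_)
  exact div_lt_self hπ (by have : (0 : ℝ) ≤ n := n.cast_nonneg; linarith)

lemma sinSeqRev_eq_cos (n k : ℕ) :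
    sinSeqRev n k = Real.cos (((k : ℝ) + 1 / 2) * (Real.pi / (2 * n + 1))) := by
  rw [sinSeqRev, ← Real.cos_pi_div_two_sub]
  congr 1
  field_simp
  ring

lemma sinSeqRev_sub_succ (n k : ℕ) :
    sinSeqRev n k - sinSeqRev n (k + 1) = epsV n * sinSeq n k := by
  rw [sinSeqRev_eq_cos, sinSeqRev_eq_cos, Real.cos_sub_cos, epsV_eq, sinSeq]
  set t := Real.pi / (2 * (n : ℝ) + 1)
  have h1 : (((k : ℝ) + 1 / 2) * t + (((k + 1 : ℕ) : ℝ) + 1 / 2) * t) / 2 = (k + 1) * t := by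
    push_cast; ring
  have h2 : (((k : ℝ) + 1 / 2) * t - (((k + 1 : ℕ) : ℝ) + 1 / 2) * t) / 2 = -(t / 2) := by
    push_cast; ring
  rw [h1, h2, Real.sin_neg]
  ring

lemma sinSeq_succ_sub (n k : ℕ) :
    sinSeq n (k + 1) - sinSeq n k = epsV n * sinSeqRev n (k + 1) := by
  rw [sinSeqRev_eq_cos, sinSeq, sinSeq, Real.sin_sub_sin, epsV_eq]
  set t := Real.pi / (2 * (n : ℝ) + 1)
  have h1 : ((((k + 1 : ℕ) : ℝ) + 1) * t - ((k : ℝ) + 1) * t) / 2 = t / 2 := by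
    push_cast; ring
  have h2 : ((((k + 1 : ℕ) : ℝ) + 1) * t + ((k : ℝ) + 1) * t) / 2
      = (((k + 1 : ℕ) : ℝ) + 1 / 2) * t := by
    push_cast; ring
  rw [h1, h2]

lemma sinSeq_zero (n : ℕ) : sinSeq n 0 = epsV n * sinSeqRev n 0 := by
  rw [sinSeqRev_eq_cos, sinSeq, epsV_eq]
  set t := Real.pi / (2 * (n : ℝ) + 1)
  have h1 : (((0 : ℕ) : ℝ) + 1) * t = 2 * (t / 2) := by push_cast; ring
  have h2 : (((0 : ℕ) : ℝ) + 1 / 2) * t = t / 2 := by push_cast; ring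
  rw [h1, h2, Real.sin_two_mul]

lemma sinSeqRev_self (n : ℕ) : sinSeqRev n n = 0 := by simp [sinSeqRev]

lemma sinSeqRev_pos {n k : ℕ} (hk : k < n) : 0 < sinSeqRev n k := by
  have hk' : (k : ℝ) < n := by exact_mod_cast hk
  have hk0 : (0 : ℝ) ≤ k := k.cast_nonneg
  have hπ := Real.pi_pos
  refine Real.sin_pos_of_pos_of_lt_pi (mul_pos (by linarith) (by positivity)) ?_
  rw [← mul_div_assoc, div_lt_iff₀ (by positivity), mul_comm]
  exact mul_lt_mul_of_pos_left (by linarith) hπ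

lemma sinSeq_eq_rev {n k : ℕ} (hk : k < n) : sinSeq n k = sinSeqRev n (n - 1 - k) := by
  rw [sinSeq, sinSeqRev]
  congr 2
  rw [Nat.sub_sub, Nat.cast_sub (by omega)]
  push_cast
  ring

lemma sinSeq_pos {n k : ℕ} (hk : k < n) : 0 < sinSeq n k := by
  rw [sinSeq_eq_rev hk]
  exact sinSeqRev_pos (by omega)

lemma sinSeq_mono {n k l : ℕ} (hkl : k ≤ l) (hl : l < n) : sinSeq n k ≤ sinSeq n l := by
  induction l, hkl using Nat.le_induction with
  | base => exact le_rfl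
  | succ m _ ih =>
    have h := sinSeq_succ_sub n m
    have := mul_pos (epsV_pos n) (sinSeqRev_pos hl)
    linarith [ih (by omega)]

lemma sum_sinSeq_sq (n : ℕ) :
    ∑ k ∈ Finset.range n, sinSeq n k ^ 2 = ∑ k ∈ Finset.range n, sinSeqRev n k ^ 2 := by
  rw [← Finset.sum_range_reflect (fun k => sinSeqRev n k ^ 2)]
  exact Finset.sum_congr rfl fun k hk => by rw [sinSeq_eq_rev (Finset.mem_range.mp hk)]

/-- Rearrangement inequality: a decreasing weight favours the decreasing sequence. -/
lemma sum_pow_mul_sinSeq_sq_le (n : ℕ) {s : ℝ} (hs0 : 0 ≤ s) (hs1 : s ≤ 1) :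
    ∑ k ∈ Finset.range n, (s ^ k) ^ 2 * sinSeq n k ^ 2
      ≤ ∑ k ∈ Finset.range n, (s ^ k) ^ 2 * sinSeqRev n k ^ 2 := by
  have hw : Antitone fun i : Fin n => (s ^ (i : ℕ)) ^ 2 := fun i j hij =>
    pow_le_pow_left₀ (by positivity) (pow_le_pow_of_le_one hs0 hs1 hij) 2
  have hq : Monotone fun i : Fin n => sinSeq n i ^ 2 := fun i j hij =>
    pow_le_pow_left₀ (sinSeq_pos i.isLt).le (sinSeq_mono hij j.isLt) 2
  have h := (hw.antivary hq).sum_mul_le_sum_mul_comp_perm (σ := Fin.revPerm)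
  rw [Finset.sum_range, Finset.sum_range]
  refine h.trans_eq (Finset.sum_congr rfl fun i _ => ?_)
  rw [sinSeq_eq_rev (Fin.isLt _), Fin.revPerm_apply, Fin.val_rev]
  congr 3
  omega

lemma sum_sinSeqRev_sq_pos {n : ℕ} (hn : 0 < n) :
    0 < ∑ k ∈ Finset.range n, sinSeqRev n k ^ 2 :=
  Finset.sum_pos (fun _ hk => pow_pos (sinSeqRev_pos (Finset.mem_range.mp hk)) 2) ⟨0, by simpa⟩

lemma sval_Vm_sub_le_of_le_one {n : ℕ} (hn : 0 < n) {s : ℝ} (hs0 : 0 ≤ s) (hs1 : s ≤ 1) :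
    sval (Vm n - (s : ℂ) • (1 : Matrix (Fin n) (Fin n) ℂ)) ≤ s * epsV n := by
  have h := sval_Vm_sub_sq_mul_sum_le (n := n) s (fun k => s ^ k * sinSeqRev n k)
    (by simp [sinSeqRev_self])
  have hpos : 0 < ∑ k ∈ Finset.range n, (s ^ k * sinSeqRev n k) ^ 2 := by
    refine Finset.sum_pos' (fun _ _ => sq_nonneg _) ⟨0, by simpa, ?_⟩
    simpa using pow_pos (sinSeqRev_pos hn) 2
  have hsum : ∑ k ∈ Finset.range n, (s ^ (k + 1) * sinSeqRev n (k + 1)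
      - s * (s ^ k * sinSeqRev n k)) ^ 2
      = (s * epsV n) ^ 2 * ∑ k ∈ Finset.range n, (s ^ k) ^ 2 * sinSeq n k ^ 2 := by
    rw [Finset.mul_sum]
    refine Finset.sum_congr rfl fun k _ => ?_
    rw [show s ^ (k + 1) * sinSeqRev n (k + 1) - s * (s ^ k * sinSeqRev n k)
      = -(s ^ (k + 1) * (sinSeqRev n k - sinSeqRev n (k + 1))) by ring, sinSeqRev_sub_succ]
    ring
  have hle : ∑ k ∈ Finset.range n, (s ^ k) ^ 2 * sinSeq n k ^ 2
      ≤ ∑ k ∈ Finset.range n, (s ^ k * sinSeqRev n k) ^ 2 := by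
    simpa only [mul_pow] using sum_pow_mul_sinSeq_sq_le n hs0 hs1
  refine le_of_sq_le_sq ?_ (mul_nonneg hs0 (epsV_pos n).le)
  refine le_of_mul_le_mul_right ((h.trans_eq hsum).trans ?_) hpos
  gcongr

lemma sval_Vm_sub_le_of_one_le {n : ℕ} (hn : 0 < n) {s : ℝ} (hs : 1 ≤ s) :
    sval (Vm n - (s : ℂ) • (1 : Matrix (Fin n) (Fin n) ℂ)) ≤ epsV n + (s - 1) := by
  have h := sval_Vm_sub_sq_mul_sum_le (n := n) s (sinSeqRev n) (sinSeqRev_self n)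
  have he := epsV_pos n
  have hs' : 0 ≤ s - 1 := by linarith
  refine le_of_sq_le_sq ?_ (by linarith)
  refine le_of_mul_le_mul_right (h.trans ?_) (sum_sinSeqRev_sq_pos hn)
  have hle : ∀ k, (sinSeqRev n (k + 1) - s * sinSeqRev n k) ^ 2
      ≤ epsV n * (epsV n + (s - 1)) * sinSeq n k ^ 2
        + (s - 1) * (epsV n + (s - 1)) * sinSeqRev n k ^ 2 := by
    intro k
    rw [show sinSeqRev n (k + 1) - s * sinSeqRev n k
      = -((sinSeqRev n k - sinSeqRev n (k + 1)) + (s - 1) * sinSeqRev n k) by ring,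
      sinSeqRev_sub_succ]
    nlinarith [mul_nonneg (mul_nonneg he.le hs') (sq_nonneg (sinSeq n k - sinSeqRev n k))]
  calc _ ≤ ∑ k ∈ Finset.range n, (epsV n * (epsV n + (s - 1)) * sinSeq n k ^ 2
        + (s - 1) * (epsV n + (s - 1)) * sinSeqRev n k ^ 2) := Finset.sum_le_sum fun k _ => hle k
    _ = _ := by
      rw [Finset.sum_add_distrib, ← Finset.mul_sum, ← Finset.mul_sum, sum_sinSeq_sq]
      ring

/-- Picone's inequality for a difference of complex numbers. -/
lemma sub_mul_div_sub_div_le_norm_sub_sq {p r : ℝ} (hp : 0 < p) (hr : 0 < r) (a b : ℂ) :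
    (p - r) * (‖a‖ ^ 2 / p - ‖b‖ ^ 2 / r) ≤ ‖b - a‖ ^ 2 := by
  have htri : (‖b‖ - ‖a‖) ^ 2 ≤ ‖b - a‖ ^ 2 :=
    sq_le_sq' (by linarith [norm_sub_norm_le a b, norm_sub_rev a b]) (norm_sub_norm_le b a)
  refine le_trans ?_ htri
  have h : (‖b‖ - ‖a‖) ^ 2 - (p - r) * (‖a‖ ^ 2 / p - ‖b‖ ^ 2 / r)
      = (p * ‖b‖ - r * ‖a‖) ^ 2 / (p * r) := by
    field_simp
    ring
  have : 0 ≤ (p * ‖b‖ - r * ‖a‖) ^ 2 / (p * r) := by positivity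
  linarith

/-- The discrete Wirtinger inequality with one free and one clamped end. -/
lemma epsV_sq_mul_sum_le {n : ℕ} (hn : 0 < n) (x : ℕ → ℂ) (hx : x n = 0) :
    epsV n ^ 2 * ∑ k ∈ Finset.range n, ‖x k‖ ^ 2
      ≤ ∑ k ∈ Finset.range n, ‖x (k + 1) - x k‖ ^ 2 := by
  set T : ℕ → ℝ := fun k => epsV n * sinSeq n k * ‖x k‖ ^ 2 / sinSeqRev n k with hT
  have hstep : ∀ k ∈ Finset.range n,
      (T k - T (k + 1)) + epsV n ^ 2 * ‖x (k + 1)‖ ^ 2 ≤ ‖x (k + 1) - x k‖ ^ 2 := by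
    intro k hk
    have hk := Finset.mem_range.mp hk
    have hp := sinSeqRev_pos hk
    have hD := sinSeqRev_sub_succ n k
    rcases (Nat.succ_le_of_lt hk).lt_or_eq with h | h
    · have hr := sinSeqRev_pos h
      refine le_trans (le_of_eq ?_) (sub_mul_div_sub_div_le_norm_sub_sq hp hr (x k) (x (k + 1)))
      rw [hD]
      have hq : sinSeq n (k + 1) = sinSeq n k + epsV n * sinSeqRev n (k + 1) := by
        linarith [sinSeq_succ_sub n k]
      simp only [hT, hq]
      simp only [Nat.succ_eq_add_one] at hr
      field_simp
      ring
    · have h : k + 1 = n := h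
      rw [h, sinSeqRev_self, sub_zero] at hD
      simp only [hT, h, hx, ← hD]
      simp [hp.ne']
  have hsum := Finset.sum_le_sum hstep
  rw [Finset.sum_add_distrib, Finset.sum_range_sub', ← Finset.mul_sum] at hsum
  have hshift : ∑ k ∈ Finset.range n, ‖x (k + 1)‖ ^ 2 + ‖x 0‖ ^ 2
      = ∑ k ∈ Finset.range n, ‖x k‖ ^ 2 := by
    rw [← Finset.sum_range_succ' (fun k => ‖x k‖ ^ 2), Finset.sum_range_succ, hx]
    simp
  have hTn : T n = 0 := by simp [hT, hx]
  have hT0 : T 0 = epsV n ^ 2 * ‖x 0‖ ^ 2 := by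
    have := (sinSeqRev_pos hn).ne'
    simp only [hT, sinSeq_zero]
    field_simp
  rw [← hshift, mul_add]
  linarith

lemma norm_sub_mul_sq (s : ℝ) (a b : ℂ) :
    ‖b - s * a‖ ^ 2 = s * ‖b - a‖ ^ 2 + (s - 1) ^ 2 * ‖a‖ ^ 2
      + (s - 1) * (‖a‖ ^ 2 - ‖b‖ ^ 2) := by
  simp only [Complex.sq_norm, Complex.normSq_apply, Complex.sub_re, Complex.sub_im, Complex.mul_re,
    Complex.mul_im, Complex.ofReal_re, Complex.ofReal_im]
  ring

lemma epsV_sq_add_sq_le_sval_sq {n : ℕ} (hn : 0 < n) {s : ℝ} (hs : 1 ≤ s) :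
    epsV n ^ 2 + (s - 1) ^ 2
      ≤ sval (Vm n - (s : ℂ) • (1 : Matrix (Fin n) (Fin n) ℂ)) ^ 2 := by
  have : Nonempty (Fin n) := ⟨⟨0, hn⟩⟩
  refine le_sval_sq _ _ fun x => ?_
  have hxn : extendZero x n = 0 := by simp [extendZero]
  have hW := epsV_sq_mul_sum_le hn (extendZero x) hxn
  rw [norm_sq_toEuclideanLin_Vm_sub, norm_sq_eq_sum_extendZero]
  simp only [norm_sub_mul_sq]
  rw [Finset.sum_add_distrib, Finset.sum_add_distrib, ← Finset.mul_sum, ← Finset.mul_sum,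
    ← Finset.mul_sum, Finset.sum_range_sub' (fun k => ‖extendZero x k‖ ^ 2), hxn]
  have h0 : 0 ≤ ∑ k ∈ Finset.range n, ‖extendZero x (k + 1) - extendZero x k‖ ^ 2 :=
    Finset.sum_nonneg fun _ _ => sq_nonneg _
  have h1 : 0 ≤ (s - 1) * (‖extendZero x 0‖ ^ 2 - ‖(0 : ℂ)‖ ^ 2) := by
    have : 0 ≤ s - 1 := by linarith
    rw [norm_zero, zero_pow two_ne_zero, sub_zero]
    positivity
  nlinarith

end SpecInclJL

open SpecInclJL in
/-- **Proposition 5.1 (bounds on the pseudospectral radius of the Jordan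
block).** For every `n ≥ 1` and ε ≥ 0, writing `α = α_n(ε_n + ε)` for the
(unique) `s ≥ 0` with `v_n(s) = s_min(V_n − s I_n) = ε_n + ε`:
`1 + ε ≤ α ≤ 1 + ε + min{ε_n, √(2 ε_n ε)}`. -/
theorem jordan_pseudospectral_radius_bounds (n : ℕ) (hn : 0 < n)
    (ε : ℝ) (hε : 0 ≤ ε) (α : ℝ) (hα0 : 0 ≤ α)
    (hα : sval (Vm n - (α : ℂ) • (1 : Matrix (Fin n) (Fin n) ℂ)) = epsV n + ε) :
    1 + ε ≤ α ∧ α ≤ 1 + ε + min (epsV n) (Real.sqrt (2 * epsV n * ε)) := by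
  have he := epsV_pos n
  have hα1 : 1 ≤ α := by
    by_contra! h
    have := sval_Vm_sub_le_of_le_one hn hα0 h.le
    nlinarith
  have hupper := sval_Vm_sub_le_of_one_le hn hα1
  have hlower := epsV_sq_add_sq_le_sval_sq hn hα1
  rw [hα] at hupper hlower
  refine ⟨by linarith, ?_⟩
  rw [← sub_le_iff_le_add', le_min_iff]
  constructor
  · have : α - 1 ≤ epsV n + ε := le_of_sq_le_sq (by nlinarith) (by linarith)
    linarith
  · have hr := Real.sqrt_nonneg (2 * epsV n * ε)
    have hr2 := Real.sq_sqrt (show 0 ≤ 2 * epsV n * ε by positivity)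
    have : α - 1 ≤ ε + √(2 * epsV n * ε) :=
      le_of_sq_le_sq (by nlinarith [mul_nonneg hε hr]) (by linarith)
    linarith
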